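/- For all n, m ≥ 1, there do not exist continuous actions of the alternating group A₄ on the spheres S^n and S^m such that the diagonal (product) action of A₄ on S^n × S^m is free. -/

import Mathlib

open Metric

/-- `Sph n` is the unit sphere `S^n`, i.e. the set of unit vectors in `ℝ^{n+1}`. -/
abbrev Sph (n : ℕ) : Type := Metric.sphere (0 : EuclideanSpace ℝ (Fin (n + 1))) 1

/-- The self-homeomorphisms of a topological space form a group under composition.
A continuous action of a group `G` on `X` (every element acting by a homeomorphism)
is then precisely a group homomorphism `G →* (X ≃ₜ X)`. -/
instance homeoGroup (X : Type*) [TopologicalSpace X] : Group (X ≃ₜ X) where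
  mul e f := f.trans e
  one := Homeomorph.refl X
  inv := Homeomorph.symm
  mul_assoc _ _ _ := Homeomorph.ext fun _ => rfl
  one_mul _ := Homeomorph.ext fun _ => rfl
  mul_one _ := Homeomorph.ext fun _ => rfl
  inv_mul_cancel e := Homeomorph.ext fun x => e.symm_apply_apply x

namespace TupleChain

open Finsupp Filter

/-- Mod 2 chains on all finite tuples of points of `X`; the empty tuple plays the role of the
augmentation. -/
abbrev Chain (X : Type*) : Type _ := List X →₀ ZMod 2

section Algebra

variable {X Y Z : Type*}

/-- A tuple, regarded as a chain. -/
noncomputable abbrev tuple (σ : List X) : Chain X := single σ 1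

/-- Adding a vertex in front of all tuples of a chain. -/
noncomputable def cone (v : X) : Chain X →ₗ[ZMod 2] Chain X :=
  lmapDomain (ZMod 2) (ZMod 2) (List.cons v)

/-- The sum of all faces of a tuple. -/
noncomputable def faces : List X → Chain X
  | [] => 0
  | v :: t => tuple t + cone v (faces t)

/-- The boundary operator. -/
noncomputable def boundary : Chain X →ₗ[ZMod 2] Chain X :=
  linearCombination (ZMod 2) faces

/-- The chain map induced by a map of vertices. -/
noncomputable def push (f : X → Y) : Chain X →ₗ[ZMod 2] Chain Y :=
  lmapDomain (ZMod 2) (ZMod 2) (List.map f)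

/-- The prism over a tuple, with bottom given by `f` and top given by `g`. -/
noncomputable def prismTuple (f g : X → Y) : List X → Chain Y
  | [] => 0
  | v :: t => tuple (f v :: g v :: t.map g) + cone (f v) (prismTuple f g t)

/-- The prism operator, a chain homotopy between `push f` and `push g`. -/
noncomputable def prism (f g : X → Y) : Chain X →ₗ[ZMod 2] Chain Y :=
  linearCombination (ZMod 2) (prismTuple f g)

/-- The chains all of whose tuples belong to `S`. -/
noncomputable abbrev chainsIn (S : Set (List X)) : Submodule (ZMod 2) (Chain X) :=
  supported (ZMod 2) (ZMod 2) S

/-- The part of a chain consisting of the tuples in `S`. -/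
noncomputable def part (S : Set (List X)) : Chain X →ₗ[ZMod 2] Chain X := by
  classical
  exact linearCombination (ZMod 2) fun σ => if σ ∈ S then tuple σ else 0

theorem chain_add_self (z : Chain X) : z + z = 0 := by
  rw [← two_smul (ZMod 2) z, show (2 : ZMod 2) = 0 from rfl, zero_smul]

@[simp] theorem cone_tuple (v : X) (σ : List X) : cone v (tuple σ) = tuple (v :: σ) := by
  simp [cone]

@[simp] theorem boundary_tuple (σ : List X) : boundary (tuple σ) = faces σ := by
  simp [boundary]

@[simp] theorem push_tuple (f : X → Y) (σ : List X) : push f (tuple σ) = tuple (σ.map f) := by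
  simp [push]

@[simp] theorem prism_tuple (f g : X → Y) (σ : List X) :
    prism f g (tuple σ) = prismTuple f g σ := by
  simp [prism]

open Classical in
@[simp] theorem part_tuple (S : Set (List X)) (σ : List X) :
    part S (tuple σ) = if σ ∈ S then tuple σ else 0 := by
  simp [part]

theorem tuple_mem {S : Set (List X)} {σ : List X} (h : σ ∈ S) : tuple σ ∈ chainsIn S :=
  single_mem_supported _ _ h

theorem map_mem_of_mem_chainsIn {M : Type*} [AddCommGroup M] [Module (ZMod 2) M]
    {N : Submodule (ZMod 2) M} (L : Chain X →ₗ[ZMod 2] M) {S : Set (List X)}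
    (h : ∀ σ ∈ S, L (tuple σ) ∈ N) {z : Chain X} (hz : z ∈ chainsIn S) : L z ∈ N := by
  rw [chainsIn, supported_eq_span_single] at hz
  have : Submodule.span (ZMod 2) ((fun σ => tuple σ) '' S) ≤ N.comap L :=
    Submodule.span_le.2 (by rintro _ ⟨σ, hσ, rfl⟩; exact h σ hσ)
  exact this hz

theorem map_eq_of_mem_chainsIn {M : Type*} [AddCommGroup M] [Module (ZMod 2) M]
    (L L' : Chain X →ₗ[ZMod 2] M) {S : Set (List X)}
    (h : ∀ σ ∈ S, L (tuple σ) = L' (tuple σ)) {z : Chain X} (hz : z ∈ chainsIn S) :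
    L z = L' z := by
  have := map_mem_of_mem_chainsIn (N := ⊥) (L - L') (fun σ hσ => by simp [h σ hσ]) hz
  simpa [sub_eq_zero] using this

theorem chain_hom_ext {M : Type*} [AddCommGroup M] [Module (ZMod 2) M]
    {L L' : Chain X →ₗ[ZMod 2] M} (h : ∀ σ, L (tuple σ) = L' (tuple σ)) : L = L' := by
  ext1 σ
  ext1
  exact h σ

theorem cone_mem {S T : Set (List X)} {v : X} (h : ∀ σ ∈ S, v :: σ ∈ T) {z : Chain X}
    (hz : z ∈ chainsIn S) : cone v z ∈ chainsIn T :=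
  map_mem_of_mem_chainsIn _ (fun σ hσ => by rw [cone_tuple]; exact tuple_mem (h σ hσ)) hz

theorem boundary_cone (v : X) (z : Chain X) :
    boundary (cone v z) = z + cone v (boundary z) := by
  have : boundary ∘ₗ cone v = LinearMap.id + cone v ∘ₗ boundary :=
    chain_hom_ext fun σ => by simp [faces]
  exact LinearMap.congr_fun this z

theorem boundary_faces (σ : List X) : boundary (faces σ) = 0 := by
  induction σ with
  | nil => simp [faces]
  | cons v t ih => simp [faces, boundary_cone, ih, chain_add_self]

theorem boundary_boundary (z : Chain X) : boundary (boundary z) = 0 := by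
  have : boundary ∘ₗ boundary = (0 : Chain X →ₗ[ZMod 2] Chain X) :=
    chain_hom_ext fun σ => by simp [boundary_faces]
  exact LinearMap.congr_fun this z

theorem push_cone (f : X → Y) (v : X) (z : Chain X) :
    push f (cone v z) = cone (f v) (push f z) := by
  have : push f ∘ₗ cone v = cone (f v) ∘ₗ push f := chain_hom_ext fun σ => by simp
  exact LinearMap.congr_fun this z

theorem boundary_push (f : X → Y) (z : Chain X) : boundary (push f z) = push f (boundary z) := by
  have : boundary ∘ₗ push f = push f ∘ₗ boundary := chain_hom_ext fun σ => by
    simp only [LinearMap.comp_apply, push_tuple, boundary_tuple]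
    induction σ with
    | nil => simp [faces]
    | cons v t ih => simp [faces, push_cone, ih]
  exact LinearMap.congr_fun this z

theorem prism_cone (f g : X → Y) (v : X) (z : Chain X) :
    prism f g (cone v z) =
      cone (f v) (cone (g v) (push g z)) + cone (f v) (prism f g z) := by
  have : prism f g ∘ₗ cone v =
      cone (f v) ∘ₗ cone (g v) ∘ₗ push g + cone (f v) ∘ₗ prism f g :=
    chain_hom_ext fun σ => by simp [prismTuple]
  exact LinearMap.congr_fun this z

theorem boundary_prism (f g : X → Y) (z : Chain X) :
    boundary (prism f g z) = push f z + push g z + prism f g (boundary z) := by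
  have : boundary ∘ₗ prism f g = push f + push g + prism f g ∘ₗ boundary :=
    chain_hom_ext fun σ => by
      simp only [LinearMap.comp_apply, LinearMap.add_apply, push_tuple, boundary_tuple,
        prism_tuple]
      induction σ with
      | nil => simp [faces, prismTuple, chain_add_self]
      | cons v t ih =>
        have hpush := boundary_push g (tuple t)
        simp only [push_tuple, boundary_tuple] at hpush
        simp only [prismTuple, faces, map_add, boundary_cone, ih, boundary_tuple, cone_tuple,
          prism_cone, List.map_cons, hpush, prism_tuple]
        generalize tuple (f v :: g v :: t.map g) = A
        generalize cone (f v) (cone (g v) (push g (faces t))) = B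
        generalize tuple (f v :: t.map g) = C
        generalize cone (f v) (prism f g (faces t)) = D
        linear_combination (norm := module) chain_add_self C
  exact LinearMap.congr_fun this z

theorem push_congr {f g : X → Y} {S : Set (List X)} (h : ∀ σ ∈ S, ∀ v ∈ σ, f v = g v)
    {z : Chain X} (hz : z ∈ chainsIn S) : push f z = push g z :=
  map_eq_of_mem_chainsIn _ _ (fun σ hσ => by
    simp only [push_tuple, List.map_congr_left (h σ hσ)]) hz

theorem push_id (z : Chain X) : push id z = z := by
  simp [push]

theorem push_push (f : X → Y) (g : Y → Z) (z : Chain X) :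
    push g (push f z) = push (g ∘ f) z := by
  have : push g ∘ₗ push f = push (g ∘ f) := chain_hom_ext fun σ => by simp
  exact LinearMap.congr_fun this z

theorem faces_mem (σ : List X) :
    faces σ ∈ chainsIn {τ | τ.Sublist σ ∧ τ.length + 1 = σ.length} := by
  induction σ with
  | nil => simp [faces]
  | cons v t ih =>
    refine add_mem (tuple_mem ⟨List.sublist_cons_self v t, rfl⟩) (cone_mem ?_ ih)
    rintro τ ⟨h, h'⟩
    exact ⟨h.cons_cons v, by simp [h']⟩

theorem boundary_mem {S T : Set (List X)}
    (h : ∀ σ ∈ S, ∀ τ : List X, τ.Sublist σ → τ.length + 1 = σ.length → τ ∈ T) {z : Chain X}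
    (hz : z ∈ chainsIn S) : boundary z ∈ chainsIn T :=
  map_mem_of_mem_chainsIn _ (fun σ hσ => by
    rw [boundary_tuple]
    exact supported_mono (fun τ hτ => h σ hσ τ hτ.1 hτ.2) (faces_mem σ)) hz

theorem push_mem {f : X → Y} {S : Set (List X)} {T : Set (List Y)}
    (h : ∀ σ ∈ S, σ.map f ∈ T) {z : Chain X} (hz : z ∈ chainsIn S) : push f z ∈ chainsIn T :=
  map_mem_of_mem_chainsIn _ (fun σ hσ => by rw [push_tuple]; exact tuple_mem (h σ hσ)) hz

theorem prismTuple_mem (f g : X → Y) (σ : List X) :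
    prismTuple f g σ ∈ chainsIn {τ | ∀ u ∈ τ, ∃ v ∈ σ, u = f v ∨ u = g v} := by
  induction σ with
  | nil => simp [prismTuple]
  | cons v t ih =>
    refine add_mem (tuple_mem ?_) (cone_mem ?_ ih)
    · intro u hu
      simp only [List.mem_cons, List.mem_map] at hu ⊢
      grind
    · intro τ hτ u hu
      simp only [List.mem_cons] at hu ⊢
      rcases hu with rfl | hu
      · exact ⟨v, by simp⟩
      · obtain ⟨w, hw, h⟩ := hτ u hu
        exact ⟨w, Or.inr hw, h⟩

theorem prism_mem {f g : X → Y} {S : Set (List X)} {T : Set (List Y)}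
    (h : ∀ σ ∈ S, ∀ τ : List Y, (∀ u ∈ τ, ∃ v ∈ σ, u = f v ∨ u = g v) → τ ∈ T) {z : Chain X}
    (hz : z ∈ chainsIn S) : prism f g z ∈ chainsIn T :=
  map_mem_of_mem_chainsIn _ (fun σ hσ => by
    rw [prism_tuple]
    exact supported_mono (h σ hσ) (prismTuple_mem f g σ)) hz

theorem part_mem {S T U : Set (List X)} (h : ∀ σ ∈ T, σ ∈ S → σ ∈ U) {z : Chain X}
    (hz : z ∈ chainsIn T) : part S z ∈ chainsIn U :=
  map_mem_of_mem_chainsIn _ (fun σ hσ => by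
    rw [part_tuple]
    split_ifs with hS
    · exact tuple_mem (h σ hσ hS)
    · exact zero_mem _) hz

theorem part_add_part_compl (S : Set (List X)) (z : Chain X) : part S z + part Sᶜ z = z := by
  have : part S + part Sᶜ = LinearMap.id := chain_hom_ext fun σ => by
    by_cases h : σ ∈ S <;> simp [h]
  exact LinearMap.congr_fun this z

theorem boundary_part_length (k : ℕ) (z : Chain X) :
    boundary (part {σ | σ.length = k + 1} z) = part {σ | σ.length = k} (boundary z) := by
  have : boundary ∘ₗ part {σ | σ.length = k + 1} =
      part {σ : List X | σ.length = k} ∘ₗ boundary := chain_hom_ext fun σ => by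
    simp only [LinearMap.comp_apply, part_tuple, boundary_tuple]
    split_ifs with h
    · rw [boundary_tuple]
      refine Eq.symm (map_eq_of_mem_chainsIn _ LinearMap.id (fun τ hτ => ?_) (faces_mem σ))
      have : τ.length = k := by have := hτ.2; simp at h; omega
      simp [this]
    · rw [map_zero]
      refine Eq.symm (map_eq_of_mem_chainsIn _ 0 (fun τ hτ => ?_) (faces_mem σ))
      have : τ.length ≠ k := by have := hτ.2; simp at h; omega
      simp [this]
  exact LinearMap.congr_fun this z

theorem part_eq_self {S : Set (List X)} {z : Chain X} (hz : z ∈ chainsIn S) : part S z = z :=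
  map_eq_of_mem_chainsIn _ LinearMap.id (fun σ hσ => by simp [hσ]) hz

end Algebra

section Fine

variable {X Y : Type*} [PseudoMetricSpace X] [PseudoMetricSpace Y]

/-- The tuples of points of `A` of mesh less than `ε`. -/
def fine (A : Set X) (ε : ℝ) : Set (List X) :=
  {σ | ∀ u ∈ σ, u ∈ A ∧ ∀ v ∈ σ, dist u v < ε}

/-- A sequence of chains in `A` whose mesh tends to zero. -/
def Infinitesimal (l : Filter ℕ) (A : Set X) (z : ℕ → Chain X) : Prop :=
  ∀ ε > 0, ∀ᶠ j in l, z j ∈ chainsIn (fine A ε)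

theorem fine_mono {A B : Set X} {ε η : ℝ} (hAB : A ⊆ B) (h : ε ≤ η) : fine A ε ⊆ fine B η :=
  fun _ hσ u hu => ⟨hAB (hσ u hu).1, fun v hv => ((hσ u hu).2 v hv).trans_le h⟩

theorem fine_of_sublist {A : Set X} {ε : ℝ} {σ τ : List X} (hσ : σ ∈ fine A ε)
    (h : τ.Sublist σ) : τ ∈ fine A ε :=
  fun u hu => ⟨(hσ u (h.subset hu)).1, fun v hv => (hσ u (h.subset hu)).2 v (h.subset hv)⟩

theorem boundary_mem_fine {A : Set X} {ε : ℝ} {z : Chain X} (hz : z ∈ chainsIn (fine A ε)) :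
    boundary z ∈ chainsIn (fine A ε) :=
  boundary_mem (fun _ hσ _ hτ _ => fine_of_sublist hσ hτ) hz

theorem push_mem_fine {f : X → Y} {A : Set X} {B : Set Y} {ε η : ℝ}
    (hf : ∀ u ∈ A, f u ∈ B) (h : ∀ u ∈ A, ∀ v ∈ A, dist u v < ε → dist (f u) (f v) < η)
    {z : Chain X} (hz : z ∈ chainsIn (fine A ε)) : push f z ∈ chainsIn (fine B η) := by
  refine push_mem (fun σ hσ u hu => ?_) hz
  obtain ⟨u, hu', rfl⟩ := List.mem_map.1 hu
  refine ⟨hf u (hσ u hu').1, fun v hv => ?_⟩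
  obtain ⟨v, hv', rfl⟩ := List.mem_map.1 hv
  exact h u (hσ u hu').1 v (hσ v hv').1 ((hσ u hu').2 v hv')

theorem prism_mem_fine {f g : X → Y} {A : Set X} {B : Set Y} {ε η : ℝ}
    (hf : ∀ u ∈ A, f u ∈ B) (hg : ∀ u ∈ A, g u ∈ B)
    (hff : ∀ u ∈ A, ∀ v ∈ A, dist u v < ε → dist (f u) (f v) < η)
    (hgg : ∀ u ∈ A, ∀ v ∈ A, dist u v < ε → dist (g u) (g v) < η)
    (hfg : ∀ u ∈ A, ∀ v ∈ A, dist u v < ε → dist (f u) (g v) < η)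
    {z : Chain X} (hz : z ∈ chainsIn (fine A ε)) : prism f g z ∈ chainsIn (fine B η) := by
  refine prism_mem (fun σ hσ τ hτ u hu => ?_) hz
  obtain ⟨u', hu', hu⟩ := hτ u hu
  have hA := (hσ u' hu').1
  refine ⟨by rcases hu with rfl | rfl; exacts [hf _ hA, hg _ hA], fun v hv => ?_⟩
  obtain ⟨v', hv', hv⟩ := hτ v hv
  have hB := (hσ v' hv').1
  have hd := (hσ u' hu').2 v' hv'
  rcases hu with rfl | rfl <;> rcases hv with rfl | rfl
  · exact hff _ hA _ hB hd
  · exact hfg _ hA _ hB hd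
  · rw [dist_comm] at hd ⊢
    exact hfg _ hB _ hA hd
  · exact hgg _ hA _ hB hd

theorem Infinitesimal.add {l : Filter ℕ} {A : Set X} {z w : ℕ → Chain X}
    (hz : Infinitesimal l A z) (hw : Infinitesimal l A w) :
    Infinitesimal l A (fun j => z j + w j) := fun ε hε => by
  filter_upwards [hz ε hε, hw ε hε] with j h h' using add_mem h h'

theorem Infinitesimal.part {l : Filter ℕ} {A : Set X} {z : ℕ → Chain X}
    (hz : Infinitesimal l A z) (S : Set (List X)) :
    Infinitesimal l A (fun j => part S (z j)) := fun ε hε => by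
  filter_upwards [hz ε hε] with j h using part_mem (fun σ hσ _ => hσ) h

theorem Infinitesimal.push {l : Filter ℕ} {A : Set X} {z : ℕ → Chain X}
    (hz : Infinitesimal l A z) {f : X → Y} {B : Set Y} (hf : ∀ u ∈ A, f u ∈ B)
    (hc : UniformContinuousOn f A) : Infinitesimal l B (fun j => push f (z j)) := fun ε hε => by
  obtain ⟨δ, hδ, h⟩ := Metric.uniformContinuousOn_iff.1 hc ε hε
  filter_upwards [hz δ hδ] with j hj using push_mem_fine hf h hj

end Fine

section Sphere

variable {E : Type*} [NormedAddCommGroup E] [InnerProductSpace ℝ E]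

/-- Radial projection to the unit sphere. -/
noncomputable def radial (x : E) : E := ‖x‖⁻¹ • x

theorem norm_radial {x : E} (hx : x ≠ 0) : ‖radial x‖ = 1 := norm_smul_inv_norm hx

theorem radial_of_norm_eq_one {x : E} (hx : ‖x‖ = 1) : radial x = x := by simp [radial, hx]

theorem dist_radial_le {x y : E} (hx : 1 / 2 ≤ ‖x‖) (hy : y ≠ 0) :
    dist (radial x) (radial y) ≤ 4 * dist x y := by
  have hx0 : 0 < ‖x‖ := by linarith
  have hy0 : 0 < ‖y‖ := norm_pos_iff.2 hy
  have h1 : radial x - radial y = ‖x‖⁻¹ • (x - y) + (‖x‖⁻¹ * (‖y‖ - ‖x‖)) • (‖y‖⁻¹ • y) := by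
    have : ‖x‖⁻¹ - ‖y‖⁻¹ = ‖x‖⁻¹ * (‖y‖ - ‖x‖) * ‖y‖⁻¹ := by field_simp
    rw [smul_smul, ← this, radial, radial]
    module
  have h2 : ‖‖y‖⁻¹ • y‖ = 1 := norm_radial hy
  have h3 : |‖y‖ - ‖x‖| ≤ ‖x - y‖ := by rw [abs_sub_comm]; exact abs_norm_sub_norm_le x y
  have h4 : ‖x‖⁻¹ ≤ 2 := by
    rw [inv_le_comm₀ hx0 two_pos]; linarith
  rw [dist_eq_norm, dist_eq_norm, h1]
  refine (norm_add_le _ _).trans ?_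
  rw [norm_smul, norm_smul, h2, mul_one, norm_mul, norm_inv, norm_norm, Real.norm_eq_abs,
    ← mul_add]
  have : 0 ≤ ‖x - y‖ := norm_nonneg _
  nlinarith [inv_nonneg.2 hx0.le]

/-- The straight line homotopy to `p`, projected to the unit sphere. -/
noncomputable def contract (p : E) (t : ℝ) (y : E) : E := radial ((1 - t) • y + t • p)

theorem half_le_norm_segment {p y : E} (hp : ‖p‖ = 1) (hy : ‖y‖ = 1)
    (h : -(1 / 2) ≤ inner ℝ p y) {t : ℝ} (h0 : 0 ≤ t) (h1 : t ≤ 1) :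
    1 / 2 ≤ ‖(1 - t) • y + t • p‖ := by
  have : ‖(1 - t) • y + t • p‖ ^ 2 = (1 - t) ^ 2 + 2 * ((1 - t) * t * inner ℝ p y) + t ^ 2 := by
    rw [norm_add_sq_real, norm_smul, norm_smul, inner_smul_left, inner_smul_right, hp, hy,
      real_inner_comm]
    simp
    ring
  have h3 : 0 ≤ (1 - t) * t := mul_nonneg (by linarith) h0
  nlinarith [norm_nonneg ((1 - t) • y + t • p), sq_nonneg (t - 1 / 2)]

variable {V : Submodule ℝ E}

/-- Infinitesimal cycles in the complement of a large cap of a sphere bound. -/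
theorem exists_boundary_of_cap {l : Filter ℕ} (hl : l ≤ atTop) {p : E} (hp : ‖p‖ = 1)
    (hpV : p ∈ V) {z : ℕ → Chain E}
    (hz : Infinitesimal l {y | y ∈ sphere (0 : E) 1 ∩ V ∧ -(1 / 2) ≤ inner ℝ p y} z)
    (hzc : ∀ᶠ j in l, boundary (z j) = 0) :
    ∃ w, Infinitesimal l (sphere (0 : E) 1 ∩ V) w ∧ ∀ᶠ j in l, boundary (w j) = z j := by
  set A : Set E := {y | y ∈ sphere (0 : E) 1 ∩ V ∧ -(1 / 2) ≤ inner ℝ p y} with hA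
  have hnorm {y : E} (hy : y ∈ A) : ‖y‖ = 1 := by simpa using hy.1.1
  have hseg {y : E} (hy : y ∈ A) {t : ℝ} (h0 : 0 ≤ t) (h1 : t ≤ 1) :
      1 / 2 ≤ ‖(1 - t) • y + t • p‖ := half_le_norm_segment hp (hnorm hy) hy.2 h0 h1
  have hne {y : E} (hy : y ∈ A) {t : ℝ} (h0 : 0 ≤ t) (h1 : t ≤ 1) :
      (1 - t) • y + t • p ≠ 0 := norm_pos_iff.1 (by linarith [hseg hy h0 h1])
  have hmem {t : ℝ} (h0 : 0 ≤ t) (h1 : t ≤ 1) (y : E) (hy : y ∈ A) :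
      contract p t y ∈ sphere (0 : E) 1 ∩ V :=
    ⟨by simpa [contract] using norm_radial (hne hy h0 h1),
      V.smul_mem _ (V.add_mem (V.smul_mem _ hy.1.2) (V.smul_mem _ hpV))⟩
  have hdist {s t : ℝ} (hs0 : 0 ≤ s) (hs1 : s ≤ 1) (ht0 : 0 ≤ t) (ht1 : t ≤ 1) {u v : E}
      (hu : u ∈ A) (hv : v ∈ A) :
      dist (contract p s u) (contract p t v) ≤ 4 * (dist u v + 2 * |s - t|) := by
    refine (dist_radial_le (hseg hu hs0 hs1) (hne hv ht0 ht1)).trans ?_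
    have : (1 - s) • u + s • p - ((1 - t) • v + t • p) =
      (1 - s) • (u - v) + (s - t) • (p - v) := by module
    rw [dist_eq_norm, dist_eq_norm, this]
    gcongr
    refine (norm_add_le _ _).trans (add_le_add ?_ ?_)
    · rw [norm_smul, Real.norm_eq_abs, abs_of_nonneg (by linarith)]
      nlinarith [norm_nonneg (u - v)]
    · rw [norm_smul, Real.norm_eq_abs, mul_comm]
      have := norm_sub_le p v
      rw [hp, hnorm hv] at this
      nlinarith [abs_nonneg (s - t)]
  have hzero {y : E} (hy : y ∈ A) : contract p 0 y = y := by
    simp [contract, radial_of_norm_eq_one (hnorm hy)]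
  have hone : contract p 1 = fun _ : E => p := by
    ext y; simp [contract, radial_of_norm_eq_one hp]
  set t : ℕ → ℕ → ℝ := fun j i => i / (j + 1) with ht
  have ht0 (j i : ℕ) : 0 ≤ t j i := by positivity
  have ht1 {j i : ℕ} (h : i ≤ j + 1) : t j i ≤ 1 := by
    have : (i : ℝ) ≤ j + 1 := by exact_mod_cast h
    exact div_le_one_of_le₀ this (by positivity)
  have htt (j i : ℕ) : |t j i - t j (i + 1)| = 1 / (j + 1) := by
    have : t j i - t j (i + 1) = -(1 / (j + 1)) := by simp only [ht]; push_cast; ring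
    rw [this, abs_neg, abs_of_nonneg (by positivity)]
  refine ⟨fun j => ∑ i ∈ Finset.range (j + 1),
    prism (contract p (t j i)) (contract p (t j (i + 1))) (z j) +
      cone p (push (contract p 1) (z j)), fun ε hε => ?_, ?_⟩
  · have hlim : ∀ᶠ j : ℕ in l, 1 / ((j : ℝ) + 1) < ε / 16 :=
      hl (tendsto_one_div_add_atTop_nhds_zero_nat.eventually_lt_const (by positivity))
    filter_upwards [hz (ε / 16) (by positivity), hlim] with j hj hj'
    refine add_mem (sum_mem fun i hi => ?_) ?_
    · have hi' : i + 1 ≤ j + 1 := by simpa using hi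
      have hi1 : i ≤ j + 1 := by omega
      refine prism_mem_fine (hmem (ht0 _ _) (ht1 hi1)) (hmem (ht0 _ _) (ht1 hi'))
        (fun u hu v hv h => ?_) (fun u hu v hv h => ?_) (fun u hu v hv h => ?_) hj
      · have := hdist (ht0 j i) (ht1 hi1) (ht0 j i) (ht1 hi1) hu hv
        simp only [sub_self, abs_zero] at this
        linarith
      · have := hdist (ht0 j (i + 1)) (ht1 hi') (ht0 j (i + 1)) (ht1 hi') hu hv
        simp only [sub_self, abs_zero] at this
        linarith
      · have := hdist (ht0 j i) (ht1 hi1) (ht0 j (i + 1)) (ht1 hi') hu hv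
        rw [htt] at this
        linarith
    · have hpS : p ∈ sphere (0 : E) 1 ∩ V := ⟨by simpa using hp, hpV⟩
      refine cone_mem (S := {σ | ∀ u ∈ σ, u = p}) ?_ (push_mem ?_ hj)
      · intro σ hσ u hu
        have hall : ∀ v ∈ p :: σ, v = p := by simpa using hσ
        refine ⟨by rwa [hall u hu], fun v hv => ?_⟩
        rw [hall u hu, hall v hv, dist_self]
        exact hε
      · intro σ _ u hu
        rw [hone] at hu
        obtain ⟨_, _, rfl⟩ := List.mem_map.1 hu
        rfl
  · filter_upwards [hzc, hz 1 one_pos] with j hj hj'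
    have hsum (k : ℕ) : boundary (∑ i ∈ Finset.range k,
        prism (contract p (t j i)) (contract p (t j (i + 1))) (z j)) =
          push (contract p (t j 0)) (z j) + push (contract p (t j k)) (z j) := by
      induction k with
      | zero => simp [chain_add_self]
      | succ k ih =>
        rw [Finset.sum_range_succ, map_add, ih, boundary_prism, hj, map_zero]
        linear_combination (norm := module) chain_add_self (push (contract p (t j k)) (z j))
    have h0 : push (contract p (t j 0)) (z j) = z j := by
      rw [push_congr (g := id) (fun σ hσ v hv => ?_) hj', push_id]
      simpa [ht] using hzero (hσ v hv).1
    have h1 : t j (j + 1) = 1 := by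
      simp only [ht]; push_cast; exact div_self (by positivity)
    rw [map_add, hsum, h0, h1, boundary_cone, boundary_push, hj, map_zero, map_zero]
    linear_combination (norm := module) chain_add_self (push (contract p 1) (z j))

end Sphere

section Degree

variable {E : Type*} [NormedAddCommGroup E] [InnerProductSpace ℝ E]

/-- Projection along meridians to the equator orthogonal to `p`. -/
noncomputable def equatorial (p y : E) : E := radial (y - (inner ℝ p y : ℝ) • p)

theorem half_le_norm_sub_inner {p y : E} (hp : ‖p‖ = 1) (hy : ‖y‖ = 1)
    (h : |(inner ℝ p y : ℝ)| ≤ 1 / 2) : 1 / 2 ≤ ‖y - (inner ℝ p y : ℝ) • p‖ := by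
  have := norm_sub_norm_le y ((inner ℝ p y : ℝ) • p)
  rw [norm_smul, hp, hy, Real.norm_eq_abs] at this
  linarith

theorem dist_equatorial_le {p y : E} (hp : ‖p‖ = 1) (hy : ‖y‖ = 1)
    (h : |(inner ℝ p y : ℝ)| ≤ 1 / 2) : dist (equatorial p y) y ≤ 4 * |(inner ℝ p y : ℝ)| := by
  have := dist_radial_le (half_le_norm_sub_inner hp hy h) (norm_ne_zero_iff.1 (hy ▸ one_ne_zero))
  rwa [radial_of_norm_eq_one hy, dist_eq_norm (_ - _), sub_sub_cancel_left, norm_neg, norm_smul,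
    hp, mul_one, Real.norm_eq_abs] at this

theorem equatorial_mem {p y : E} {V : Submodule ℝ E} (hp : ‖p‖ = 1) (hpV : p ∈ V)
    (hy : y ∈ sphere (0 : E) 1 ∩ V) (h : |(inner ℝ p y : ℝ)| ≤ 1 / 2) :
    equatorial p y ∈ sphere (0 : E) 1 ∩ ((ℝ ∙ p)ᗮ ⊓ V : Submodule ℝ E) := by
  have hy1 : ‖y‖ = 1 := by simpa using hy.1
  have hne : y - (inner ℝ p y : ℝ) • p ≠ 0 :=
    norm_pos_iff.1 (by linarith [half_le_norm_sub_inner hp hy1 h])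
  refine ⟨by simpa [equatorial] using norm_radial hne, ?_⟩
  refine Submodule.smul_mem _ _ ⟨?_, V.sub_mem hy.2 (V.smul_mem _ hpV)⟩
  rw [SetLike.mem_coe, Submodule.mem_orthogonal_singleton_iff_inner_right, inner_sub_right,
    inner_smul_right, real_inner_self_eq_norm_sq, hp]
  ring

/-- The part of an infinitesimal cycle lying above the equator is bounded by an infinitesimal
chain concentrated near the equator. -/
theorem boundary_part_nonneg_mem_fine {p : E} (hp : ‖p‖ = 1) {V : Submodule ℝ E} {ε : ℝ}
    {z : Chain E} (hz : z ∈ chainsIn (fine (sphere (0 : E) 1 ∩ V) ε)) (hzc : boundary z = 0) :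
    part {σ | ∀ u ∈ σ, 0 ≤ (inner ℝ p u : ℝ)}ᶜ z ∈
        chainsIn (fine {y | y ∈ sphere (0 : E) 1 ∩ V ∧ (inner ℝ p y : ℝ) ≤ ε} ε) ∧
      boundary (part {σ | ∀ u ∈ σ, 0 ≤ (inner ℝ p u : ℝ)} z) ∈
        chainsIn (fine {y | y ∈ sphere (0 : E) 1 ∩ V ∧
          0 ≤ (inner ℝ p y : ℝ) ∧ (inner ℝ p y : ℝ) ≤ ε} ε) := by
  set pos : Set (List E) := {σ | ∀ u ∈ σ, 0 ≤ (inner ℝ p u : ℝ)} with hpos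
  have hneg : part posᶜ z ∈
      chainsIn (fine {y | y ∈ sphere (0 : E) 1 ∩ V ∧ (inner ℝ p y : ℝ) ≤ ε} ε) := by
    refine part_mem (fun σ hσ hσn u hu => ⟨⟨(hσ u hu).1, ?_⟩, (hσ u hu).2⟩) hz
    simp only [hpos, Set.mem_compl_iff, Set.mem_ofPred_eq, not_forall, not_le] at hσn
    obtain ⟨v, hv, hv0⟩ := hσn
    have h1 : (inner ℝ p (u - v) : ℝ) ≤ ‖p‖ * ‖u - v‖ := real_inner_le_norm _ _
    rw [inner_sub_right, hp, one_mul, ← dist_eq_norm] at h1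
    linarith [(hσ u hu).2 v hv]
  refine ⟨hneg, ?_⟩
  have heq : boundary (part pos z) = boundary (part posᶜ z) := by
    have h1 := congrArg boundary (part_add_part_compl pos z)
    rw [map_add, hzc] at h1
    linear_combination (norm := module) h1 - chain_add_self (boundary (part posᶜ z))
  have h1 : boundary (part pos z) ∈
      chainsIn (fine {y | y ∈ sphere (0 : E) 1 ∩ V ∧ 0 ≤ (inner ℝ p y : ℝ)} ε) :=
    boundary_mem_fine (part_mem (fun σ hσ hσp u hu =>
      ⟨⟨(hσ u hu).1, hσp u hu⟩, (hσ u hu).2⟩) hz)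
  have h2 := boundary_mem_fine hneg
  rw [← heq] at h2
  refine supported_mono ?_
    ((supported_inter (M := ZMod 2) (R := ZMod 2) _ _).symm ▸ Submodule.mem_inf.2 ⟨h1, h2⟩)
  exact fun σ hσ u hu =>
    ⟨⟨(hσ.1 u hu).1.1, (hσ.1 u hu).1.2, (hσ.2 u hu).1.2⟩, (hσ.1 u hu).2⟩

variable [FiniteDimensional ℝ E]

/-- The reduced mod 2 homology of the unit sphere of a `d`-dimensional space, computed with
infinitesimal chains, is detected by one functional, concentrated on tuples of `d` points. -/
theorem exists_degree {l : Filter ℕ} (hl : l ≤ atTop) (d : ℕ) :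
    ∀ V : Submodule ℝ E, Module.finrank ℝ V = d → ∃ D : Chain E →ₗ[ZMod 2] ZMod 2,
      (∀ σ : List E, σ.length < d → D (tuple σ) = 0) ∧
      ∀ z, Infinitesimal l (sphere (0 : E) 1 ∩ V) z → (∀ᶠ j in l, boundary (z j) = 0) →
        (∀ᶠ j in l, D (z j) = 0) →
        ∃ w, Infinitesimal l (sphere (0 : E) 1 ∩ V) w ∧ ∀ᶠ j in l, boundary (w j) = z j := by
  induction d with
  | zero =>
    intro V hV
    rw [Submodule.finrank_eq_zero] at hV
    subst hV
    refine ⟨lapply [], by simp, fun z hz _ hD =>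
      ⟨0, fun ε _ => .of_forall fun _ => zero_mem _, ?_⟩⟩
    filter_upwards [hz 1 one_pos, hD] with j hj hD
    have : z j = (lsingle [] ∘ₗ lapply []) (z j) :=
      map_eq_of_mem_chainsIn LinearMap.id (lsingle [] ∘ₗ lapply []) (fun σ hσ => by
        cases σ with
        | nil => simp
        | cons v t =>
          obtain ⟨h1, h2⟩ := (hσ v (by simp)).1
          have h0 : v = 0 := by simpa using h2
          simp [h0] at h1) hj
    rw [this, LinearMap.comp_apply, hD]
    simp
  | succ d ih =>
    intro V hV
    obtain ⟨x, hxV, hx⟩ : ∃ x ∈ V, x ≠ 0 := by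
      refine V.ne_bot_iff.1 fun h => ?_
      rw [h, finrank_bot] at hV
      omega
    obtain ⟨p, hp, hpV⟩ : ∃ p : E, ‖p‖ = 1 ∧ p ∈ V :=
      ⟨radial x, norm_radial hx, V.smul_mem _ hxV⟩
    have hp0 : p ≠ 0 := norm_ne_zero_iff.1 (hp ▸ one_ne_zero)
    have hV' : Module.finrank ℝ ((ℝ ∙ p)ᗮ ⊓ V : Submodule ℝ E) = d := by
      have := Submodule.finrank_add_inf_finrank_orthogonal
        ((Submodule.span_singleton_le_iff_mem p V).2 hpV)
      rw [finrank_span_singleton hp0] at this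
      omega
    obtain ⟨D, hD, hDz⟩ := ih _ hV'
    set pos : Set (List E) := {σ | ∀ u ∈ σ, 0 ≤ (inner ℝ p u : ℝ)} with hpos
    refine ⟨D ∘ₗ push (equatorial p) ∘ₗ boundary ∘ₗ part pos, fun σ hσ => ?_,
      fun z hz hzc hzD => ?_⟩
    · by_cases hσp : σ ∈ pos
      · simp only [LinearMap.comp_apply, part_tuple, hσp, if_true, boundary_tuple]
        refine map_eq_of_mem_chainsIn (D ∘ₗ push (equatorial p)) 0 (fun τ hτ => ?_) (faces_mem σ)
        rw [LinearMap.comp_apply, push_tuple, LinearMap.zero_apply]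
        exact hD _ (by have := hτ.2; simp; omega)
      · simp [hσp]
    set u : ℕ → Chain E := fun j => boundary (part pos (z j)) with hu
    have hcap {ε : ℝ} (hε : 0 < ε) :
        ∀ᶠ j in l, z j ∈ chainsIn (fine (sphere (0 : E) 1 ∩ V) ε) ∧ boundary (z j) = 0 :=
      (hz ε hε).and hzc
    have hun {ε : ℝ} (hε : 0 < ε) (hε' : ε ≤ 1 / 2) :
        ∀ᶠ j in l, push (equatorial p) (u j) ∈
            chainsIn (fine (sphere (0 : E) 1 ∩ ((ℝ ∙ p)ᗮ ⊓ V : Submodule ℝ E)) (9 * ε)) ∧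
          prism id (equatorial p) (u j) ∈ chainsIn (fine {y | y ∈ sphere (0 : E) 1 ∩ V ∧
            0 ≤ (inner ℝ p y : ℝ) ∧ (inner ℝ p y : ℝ) ≤ ε} (9 * ε)) := by
      filter_upwards [hcap hε] with j hj
      have hj' := (boundary_part_nonneg_mem_fine hp hj.1 hj.2).2
      set B : Set E := {y | y ∈ sphere (0 : E) 1 ∩ V ∧
            0 ≤ (inner ℝ p y : ℝ) ∧ (inner ℝ p y : ℝ) ≤ ε} with hB
      have habs {y : E} (hy : y ∈ B) : |(inner ℝ p y : ℝ)| ≤ ε := by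
        rw [abs_of_nonneg hy.2.1]; exact hy.2.2
      have hmem (y : E) (hy : y ∈ B) := equatorial_mem hp hpV hy.1 ((habs hy).trans hε')
      have hd {y : E} (hy : y ∈ B) : dist (equatorial p y) y ≤ 4 * ε := by
        have := dist_equatorial_le hp (by simpa using hy.1.1) ((habs hy).trans hε')
        linarith [habs hy]
      have hpp (u) (hu : u ∈ B) (v) (hv : v ∈ B) (h : dist u v < ε) :
          dist (equatorial p u) (equatorial p v) < 9 * ε := by
        have h1 := dist_triangle4 (equatorial p u) u v (equatorial p v)
        have h2 := hd hv
        rw [dist_comm] at h2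
        linarith [hd hu]
      refine ⟨push_mem_fine hmem hpp hj',
        prism_mem_fine (fun y hy => hy) (fun y hy => ?_) (fun u hu v hv h => ?_) hpp
          (fun u hu v hv h => ?_) hj'⟩
      · have h0 : (inner ℝ p (equatorial p y) : ℝ) = 0 :=
          Submodule.mem_orthogonal_singleton_iff_inner_right.1 (hmem y hy).2.1
        exact ⟨⟨(hmem y hy).1, (hmem y hy).2.2⟩, h0.ge, h0.le.trans hε.le⟩
      · linarith
      · have h1 := dist_triangle u v (equatorial p v)
        have h2 := hd hv
        rw [dist_comm] at h2
        linarith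
    have hsmall {ε : ℝ} (hε : 0 < ε) : ∃ η, 0 < η ∧ η ≤ 1 / 2 ∧ η ≤ ε ∧ 9 * η ≤ ε :=
      ⟨min (ε / 9) (1 / 2), by positivity, min_le_right _ _,
        by linarith [min_le_left (ε / 9) (1 / 2)], by linarith [min_le_left (ε / 9) (1 / 2)]⟩
    obtain ⟨w, hw, hwu⟩ := hDz (fun j => push (equatorial p) (u j))
      (fun ε hε => by
        obtain ⟨η, h0, h1, -, h2⟩ := hsmall hε
        filter_upwards [hun h0 h1] with j hj using supported_mono (fine_mono subset_rfl h2) hj.1)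
      (.of_forall fun j => by rw [boundary_push, hu, boundary_boundary, map_zero]) hzD
    set w' : ℕ → Chain E := fun j => prism id (equatorial p) (u j) + w j with hw'
    have hw'u : ∀ᶠ j in l, boundary (w' j) = u j := by
      filter_upwards [hwu] with j hj
      rw [hw', map_add, hj, boundary_prism, push_id, hu, boundary_boundary, map_zero]
      linear_combination (norm := module)
        chain_add_self (push (equatorial p) (boundary (part pos (z j))))
    have hw'n {ε : ℝ} (hε : 0 < ε) : ∀ᶠ j in l, w' j ∈
        chainsIn (fine {y | y ∈ sphere (0 : E) 1 ∩ V ∧ |(inner ℝ p y : ℝ)| ≤ 1 / 2} ε) := by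
      obtain ⟨η, h0, h1, -, h2⟩ := hsmall hε
      filter_upwards [hun h0 h1, hw ε hε] with j hj hjw
      refine add_mem (supported_mono (fine_mono ?_ h2) hj.2)
        (supported_mono (fine_mono ?_ le_rfl) hjw) <;> intro y hy
      · refine ⟨hy.1, ?_⟩
        rw [abs_of_nonneg hy.2.1]; exact hy.2.2.trans h1
      · refine ⟨⟨hy.1, hy.2.2⟩, ?_⟩
        rw [Submodule.mem_orthogonal_singleton_iff_inner_right.1 hy.2.1]; norm_num
    obtain ⟨x₁, hx₁, hx₁'⟩ := exists_boundary_of_cap hl hp hpV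
      (z := fun j => part pos (z j) + w' j)
      (fun ε hε => by
        filter_upwards [hz ε hε, hw'n hε] with j hj hj'
        refine add_mem (part_mem (fun σ hσ hσp u hu => ⟨⟨(hσ u hu).1, ?_⟩, (hσ u hu).2⟩) hj)
          (supported_mono (fine_mono ?_ le_rfl) hj')
        · exact fun y hy => ⟨hy.1, (abs_le.1 hy.2).1⟩
        · have := hσp u hu
          linarith)
      (by
        filter_upwards [hw'u] with j hj
        rw [map_add, hj]
        exact chain_add_self _)
    obtain ⟨x₂, hx₂, hx₂'⟩ := exists_boundary_of_cap hl (p := -p) (by simpa using hp)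
      (V.neg_mem hpV) (z := fun j => part posᶜ (z j) + w' j)
      (fun ε hε => by
        obtain ⟨η, h0, h1, h2, -⟩ := hsmall hε
        filter_upwards [hcap h0, hw'n hε] with j hj hj'
        refine add_mem (supported_mono (fine_mono ?_ h2)
          (boundary_part_nonneg_mem_fine hp hj.1 hj.2).1)
          (supported_mono (fine_mono ?_ le_rfl) hj') <;> intro y hy <;>
          refine ⟨hy.1, ?_⟩ <;> rw [inner_neg_left]
        · linarith [hy.2]
        · linarith [(abs_le.1 hy.2).2])
      (by
        filter_upwards [hw'u, hzc] with j hj hj'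
        have h1 := congrArg boundary (part_add_part_compl pos (z j))
        rw [map_add, hj'] at h1
        rw [map_add, hj, hu, add_comm]
        exact h1)
    refine ⟨fun j => x₁ j + x₂ j, hx₁.add hx₂, ?_⟩
    filter_upwards [hx₁', hx₂'] with j h1 h2
    rw [map_add, h1, h2]
    linear_combination (norm := module) part_add_part_compl pos (z j) + chain_add_self (w' j)

end Degree

section Alternation

variable {X : Type*}

/-- The cup product of the coboundaries of the functions `s i`, `s (i + 1)`, ... -/
def alternTuple (s : ℕ → X → ZMod 2) : ℕ → List X → ZMod 2
  | _, [] => 0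
  | _, [_] => 1
  | i, v :: w :: t => (s i v + s i w) * alternTuple s (i + 1) (w :: t)

/-- The cup product of `s i` with the coboundaries of `s (i + 1)`, `s (i + 2)`, ... -/
def signTuple (s : ℕ → X → ZMod 2) (i : ℕ) : List X → ZMod 2
  | [] => 0
  | v :: t => s i v * alternTuple s (i + 1) (v :: t)

/-- `alternTuple` as a functional on chains. -/
noncomputable def altern (s : ℕ → X → ZMod 2) (i : ℕ) : Chain X →ₗ[ZMod 2] ZMod 2 :=
  linearCombination (ZMod 2) (alternTuple s i)

/-- `signTuple` as a functional on chains. -/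
noncomputable def signed (s : ℕ → X → ZMod 2) (i : ℕ) : Chain X →ₗ[ZMod 2] ZMod 2 :=
  linearCombination (ZMod 2) (signTuple s i)

variable (s : ℕ → X → ZMod 2) (i : ℕ)

@[simp] theorem altern_tuple (σ : List X) : altern s i (tuple σ) = alternTuple s i σ := by
  simp [altern]

@[simp] theorem signed_tuple (σ : List X) : signed s i (tuple σ) = signTuple s i σ := by
  simp [signed]

theorem altern_cone_cone (v w : X) (z : Chain X) :
    altern s i (cone v (cone w z)) = (s i v + s i w) * altern s (i + 1) (cone w z) := by
  have : altern s i ∘ₗ cone v ∘ₗ cone w = (s i v + s i w) • altern s (i + 1) ∘ₗ cone w :=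
    chain_hom_ext fun σ => by simp [alternTuple]
  exact LinearMap.congr_fun this z

theorem signed_cone (v : X) (z : Chain X) :
    signed s i (cone v z) = s i v * altern s (i + 1) (cone v z) := by
  have : signed s i ∘ₗ cone v = s i v • altern s (i + 1) ∘ₗ cone v :=
    chain_hom_ext fun σ => by simp [signTuple]
  exact LinearMap.congr_fun this z

theorem altern_faces (σ : List X) : altern s i (faces σ) = 0 := by
  induction σ generalizing i with
  | nil => simp [faces]
  | cons v t ih =>
    cases t with
    | nil => simp [faces, alternTuple]
    | cons w t =>
      have h := ih (i + 1)
      simp only [faces, map_add, altern_tuple, cone_tuple, altern_cone_cone] at h ⊢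
      cases t with
      | nil =>
        simp [faces, alternTuple]
        decide
      | cons x t =>
        simp only [alternTuple] at h ⊢
        have h2 : (2 : ZMod 2) = 0 := rfl
        linear_combination (s i v + s i w) * h +
          s i x * alternTuple s (i + 1) (x :: t) * h2

theorem signed_boundary {k : ℕ} {z : Chain X} (hz : z ∈ chainsIn {σ | σ.length = k + 2}) :
    signed s i (boundary z) = altern s i z := by
  refine map_eq_of_mem_chainsIn (signed s i ∘ₗ boundary) _ (fun σ hσ => ?_) hz
  match σ, hσ with
  | v :: w :: t, _ =>
    have h := altern_faces s (i + 1) (v :: w :: t)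
    rw [faces, map_add, altern_tuple] at h
    rw [LinearMap.comp_apply, boundary_tuple, faces, map_add, signed_cone, signed_tuple, signTuple,
      altern_tuple, alternTuple]
    have h2 : (2 : ZMod 2) = 0 := rfl
    linear_combination s i v * h - s i v * alternTuple s (i + 1) (w :: t) * h2

variable {s i}

theorem alternTuple_map {g : X → X} {r : ℕ → ZMod 2} {σ : List X}
    (h : ∀ v ∈ σ, ∀ i, s i (g v) = s i v + r i) :
    alternTuple s i (σ.map g) = alternTuple s i σ := by
  induction σ generalizing i with
  | nil => simp
  | cons v t ih =>
    cases t with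
    | nil => simp [alternTuple]
    | cons w t =>
      have ih' := ih (i := i + 1) fun x hx => h x (List.mem_cons_of_mem v hx)
      simp only [List.map_cons, alternTuple] at ih' ⊢
      rw [ih', h v (by simp), h w (by simp)]
      have h2 : (2 : ZMod 2) = 0 := rfl
      linear_combination r i * alternTuple s (i + 1) (w :: t) * h2

theorem signed_push {g : X → X} {r : ℕ → ZMod 2} {S : Set X}
    (h : ∀ v ∈ S, ∀ i, s i (g v) = s i v + r i) {z : Chain X}
    (hz : z ∈ chainsIn {σ | ∀ v ∈ σ, v ∈ S}) :
    signed s i (push g z) = signed s i z + r i * altern s (i + 1) z := by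
  refine map_eq_of_mem_chainsIn (signed s i ∘ₗ push g) (signed s i + r i • altern s (i + 1))
    (fun σ hσ => ?_) hz
  rw [LinearMap.comp_apply, push_tuple, signed_tuple, LinearMap.add_apply, LinearMap.smul_apply,
    signed_tuple, altern_tuple, smul_eq_mul]
  cases σ with
  | nil => simp [signTuple, alternTuple]
  | cons v t =>
    have := alternTuple_map (i := i + 1) fun x hx => h x (hσ x hx)
    rw [List.map_cons] at this ⊢
    rw [signTuple, signTuple, this, h v (hσ v (by simp))]
    ring

end Alternation

section Involutions

theorem mem_chainsIn_of_fine {X : Type*} [PseudoMetricSpace X] {S : Set X} {ε : ℝ} {z : Chain X}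
    (hz : z ∈ chainsIn (fine S ε)) : z ∈ chainsIn {σ | ∀ v ∈ σ, v ∈ S} :=
  supported_mono (fun _ hσ v hv => (hσ v hv).1) hz

theorem push_push_of_involution {X : Type*} {S : Set X} {g : X → X} (hg : ∀ x ∈ S, g (g x) = x)
    {z : Chain X} (hz : z ∈ chainsIn {σ | ∀ v ∈ σ, v ∈ S}) : push g (push g z) = z := by
  rw [push_push, push_congr (f := g ∘ g) (g := id) (S := {σ | ∀ v ∈ σ, v ∈ S})
    (fun σ hσ v hv => hg v (hσ v hv)) hz,
    push_id]

/-- An infinitesimal chain representing the fundamental cycle of an equivariant map from the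
`k`-sphere with its antipodal involution, cut along the equator. -/
theorem exists_hemisphere {X : Type*} [PseudoMetricSpace X] {l : Filter ℕ} {S : Set X}
    {d : ℕ} {D : Chain X →ₗ[ZMod 2] ZMod 2}
    (hD : ∀ σ : List X, σ.length < d → D (tuple σ) = 0)
    (hDz : ∀ z, Infinitesimal l S z → (∀ᶠ j in l, boundary (z j) = 0) →
        (∀ᶠ j in l, D (z j) = 0) → ∃ w, Infinitesimal l S w ∧ ∀ᶠ j in l, boundary (w j) = z j)
    {y : X} (hy : y ∈ S) {g : X → X} (hgS : ∀ x ∈ S, g x ∈ S) (hgc : UniformContinuousOn g S)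
    (hg : ∀ x ∈ S, g (g x) = x) (k : ℕ) (hk : k < d) :
    ∃ c : ℕ → Chain X, Infinitesimal l S c ∧ (∀ j, c j ∈ chainsIn {σ | σ.length = k + 1}) ∧
      (∀ᶠ j in l, boundary (c j + push g (c j)) = 0) ∧
      ∀ᶠ j in l, ∀ s : ℕ → X → ZMod 2, (∀ v ∈ S, ∀ i, s i (g v) = s i v + 1) →
        ∀ i, altern s i (c j) = 1 := by
  induction k with
  | zero =>
    refine ⟨fun _ => tuple [y], fun ε hε => .of_forall fun _ => tuple_mem fun u hu => ?_,
      fun _ => tuple_mem rfl, .of_forall fun _ => ?_, .of_forall fun _ s _ i => ?_⟩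
    · simp only [List.mem_singleton] at hu
      subst hu
      refine ⟨hy, fun v hv => ?_⟩
      simp only [List.mem_singleton] at hv
      subst hv
      rwa [dist_self]
    · simp [faces, chain_add_self]
    · simp [alternTuple]
  | succ k ih =>
    obtain ⟨c, hc, hcl, hcb, hcs⟩ := ih (by omega)
    obtain ⟨w, hw, hwb⟩ := hDz (fun j => c j + push g (c j)) (hc.add (hc.push hgS hgc)) hcb
      (.of_forall fun j => by
        refine map_eq_of_mem_chainsIn D 0 (fun σ hσ => hD σ ?_)
          (add_mem (hcl j) (push_mem (fun σ hσ => ?_) (hcl j)))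
        · simp only [Set.mem_ofPred_eq] at hσ
          omega
        · simpa using hσ)
    have hb : ∀ᶠ j in l,
        boundary (part {σ | σ.length = k + 1 + 1} (w j)) = c j + push g (c j) := by
      filter_upwards [hwb] with j hj
      rw [boundary_part_length, hj]
      exact part_eq_self (add_mem (hcl j) (push_mem (fun σ hσ => by simpa using hσ) (hcl j)))
    have hlen (j : ℕ) : part {σ | σ.length = k + 1 + 1} (w j) ∈
        chainsIn {σ | σ.length = k + 1 + 1} :=
      part_mem (T := Set.univ) (fun σ _ hσ => hσ) (by simp [chainsIn, supported_univ])
    refine ⟨fun j => part {σ | σ.length = k + 1 + 1} (w j), hw.part _, hlen, ?_, ?_⟩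
    · filter_upwards [hb, hc 1 one_pos] with j hj hj'
      rw [map_add, boundary_push, hj, map_add,
        push_push_of_involution hg (mem_chainsIn_of_fine hj'),
        add_comm (c j), chain_add_self]
    · filter_upwards [hb, hcs, hc 1 one_pos] with j hj hjs hj' s hs i
      rw [← signed_boundary s i (hlen j), hj, map_add, signed_push (r := fun _ => 1) hs
        (mem_chainsIn_of_fine hj'), hjs s hs, ← add_assoc, CharTwo.add_self_eq_zero]
      simp

variable {E : Type*} [NormedAddCommGroup E] [InnerProductSpace ℝ E]

/-- Two commuting involutions of a sphere cannot both be detected by sign functions. -/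
theorem false_of_sign_functions [FiniteDimensional ℝ E] {n : ℕ}
    (hE : Module.finrank ℝ E = n + 1) {a b : E → E}
    (haS : ∀ x ∈ sphere (0 : E) 1, a x ∈ sphere (0 : E) 1)
    (hbS : ∀ x ∈ sphere (0 : E) 1, b x ∈ sphere (0 : E) 1)
    (hac : UniformContinuousOn a (sphere (0 : E) 1))
    (hbc : UniformContinuousOn b (sphere (0 : E) 1))
    (ha : ∀ x ∈ sphere (0 : E) 1, a (a x) = x) (hb : ∀ x ∈ sphere (0 : E) 1, b (b x) = x)
    {s t : ℕ → E → ZMod 2}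
    (hsa : ∀ v ∈ sphere (0 : E) 1, ∀ i, s i (a v) = s i v + 1)
    (hsb : ∀ v ∈ sphere (0 : E) 1, ∀ i, s i (b v) = s i v)
    (htb : ∀ v ∈ sphere (0 : E) 1, ∀ i, t i (b v) = t i v + 1)
    (hs : ∃ ε > 0, ∀ σ ∈ fine (sphere (0 : E) 1) ε, σ.length = n + 2 → alternTuple s 0 σ = 0)
    (ht : ∃ ε > 0, ∀ σ ∈ fine (sphere (0 : E) 1) ε, σ.length = n + 2 → alternTuple t 0 σ = 0) :
    False := by
  set S := sphere (0 : E) 1 with hS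
  set l : Ultrafilter ℕ := hyperfilter ℕ
  have hl : (l : Filter ℕ) ≤ atTop := by
    rw [← Nat.cofinite_eq_atTop]; exact hyperfilter_le_cofinite
  obtain ⟨D, hD, hDz⟩ := exists_degree hl (n + 1) (⊤ : Submodule ℝ E) (by rwa [finrank_top])
  simp only [Submodule.top_coe, Set.inter_univ, ← hS] at hDz
  have : Nontrivial E := Module.nontrivial_of_finrank_pos (R := ℝ) (by omega)
  obtain ⟨y, hy⟩ : S.Nonempty := NormedSpace.sphere_nonempty.2 zero_le_one
  obtain ⟨c, hc, hcl, hcb, hcs⟩ := exists_hemisphere hD hDz hy haS hac ha n (by omega)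
  obtain ⟨e, he, hel, heb, hes⟩ := exists_hemisphere hD hDz hy hbS hbc hb n (by omega)
  have key {z : ℕ → Chain E} (hz : Infinitesimal l S z) (hzb : ∀ᶠ j in l, boundary (z j) = 0)
      (hzl : ∀ j, z j ∈ chainsIn {σ | σ.length = n + 1}) (hzD : ∀ᶠ j in l, D (z j) = 0)
      {r : ℕ → E → ZMod 2}
      (hr : ∃ ε > 0, ∀ σ ∈ fine S ε, σ.length = n + 2 → alternTuple r 0 σ = 0) :
      ∀ᶠ j in l, signed r 0 (z j) = 0 := by
    obtain ⟨w, hw, hwb⟩ := hDz z hz hzb hzD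
    obtain ⟨ε, hε, hr⟩ := hr
    filter_upwards [hw ε hε, hwb] with j hj hjb
    have hlen : part {σ | σ.length = n + 1 + 1} (w j) ∈
        chainsIn (fine S ε ∩ {σ | σ.length = n + 2}) :=
      part_mem (fun _ hσ hσ' => Set.mem_inter hσ hσ') hj
    have hb : boundary (part {σ | σ.length = n + 1 + 1} (w j)) = z j := by
      rw [boundary_part_length, hjb]
      exact part_eq_self (hzl j)
    rw [← hb, signed_boundary r 0 (supported_mono Set.inter_subset_right hlen)]
    exact map_eq_of_mem_chainsIn _ 0 (fun σ hσ => by simpa using hr σ hσ.1 hσ.2) hlen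
  have hodd {g : E → E} {f : ℕ → Chain E} (hf : Infinitesimal l S f)
      (hfs : ∀ᶠ j in l, ∀ s : ℕ → E → ZMod 2, (∀ v ∈ S, ∀ i, s i (g v) = s i v + 1) →
        ∀ i, altern s i (f j) = 1)
      {r : ℕ → E → ZMod 2} (hr : ∀ v ∈ S, ∀ i, r i (g v) = r i v + 1) :
      ∀ᶠ j in l, signed r 0 (f j + push g (f j)) = 1 := by
    filter_upwards [hfs, hf 1 one_pos] with j hj hj'
    rw [map_add, signed_push (r := fun _ => 1) hr (mem_chainsIn_of_fine hj'), hj r hr,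
      ← add_assoc, CharTwo.add_self_eq_zero]
    simp
  have heven {g : E → E} {f : ℕ → Chain E} (hf : Infinitesimal l S f)
      {r : ℕ → E → ZMod 2} (hr : ∀ v ∈ S, ∀ i, r i (g v) = r i v) :
      ∀ᶠ j in l, signed r 0 (f j + push g (f j)) = 0 := by
    filter_upwards [hf 1 one_pos] with j hj
    rw [map_add, signed_push (r := fun _ => 0) (by simpa using hr) (mem_chainsIn_of_fine hj),
      zero_mul, add_zero, CharTwo.add_self_eq_zero]
  have hlen {g : E → E} {f : ℕ → Chain E} (hf : ∀ j, f j ∈ chainsIn {σ | σ.length = n + 1})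
      (j : ℕ) : f j + push g (f j) ∈ chainsIn {σ | σ.length = n + 1} :=
    add_mem (hf j) (push_mem (fun σ hσ => by simpa using hσ) (hf j))
  have hcycle : ∀ᶠ j in l, D (c j + push a (c j)) = 0 ∨ D (e j + push b (e j)) = 0 ∨
      D (c j + push a (c j) + (e j + push b (e j))) = 0 := by
    refine .of_forall fun j => ?_
    rw [map_add D (c j + push a (c j))]
    generalize D (c j + push a (c j)) = x
    generalize D (e j + push b (e j)) = y
    revert x y
    decide
  have hca := hc.add (hc.push haS hac)
  have heb' := he.add (he.push hbS hbc)
  rcases Ultrafilter.eventually_or.1 hcycle with h | h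
  · obtain ⟨j, h0, h1⟩ := ((key hca hcb (hlen hcl) h hs).and (hodd hc hcs hsa)).exists
    exact zero_ne_one (h0.symm.trans h1)
  rcases Ultrafilter.eventually_or.1 h with h | h
  · obtain ⟨j, h0, h1⟩ := ((key heb' heb (hlen hel) h ht).and (hodd he hes htb)).exists
    exact zero_ne_one (h0.symm.trans h1)
  · obtain ⟨j, h0, h1, h2⟩ := ((key (hca.add heb')
      (by filter_upwards [hcb, heb] with j h h' using by rw [map_add, h, h', add_zero])
      (fun j => add_mem (hlen hcl j) (hlen hel j)) h hs).and
        ((hodd hc hcs hsa).and (heven he hsb))).exists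
    rw [map_add, h1, h2] at h0
    exact one_ne_zero h0

end Involutions

end TupleChain

section Equivariant

open MeasureTheory

/-- Every continuous map from the unit sphere of `E` to `E` is a uniform limit of nowhere
vanishing ones. -/
theorem exists_nonvanishing_approx {E : Type*} [NormedAddCommGroup E] [InnerProductSpace ℝ E]
    [FiniteDimensional ℝ E] [Nontrivial E] (f : C(sphere (0 : E) 1, E)) {ε : ℝ} (hε : 0 < ε) :
    ∃ P : C(sphere (0 : E) 1, E), (∀ x, P x ≠ 0) ∧ ∀ x, ‖P x - f x‖ < ε := by
  borelize E
  obtain ⟨F, hF⟩ := f.exists_restrict_eq isClosed_sphere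
  obtain ⟨g, hg, hgF⟩ : ∃ g : C(E, E), ContDiff ℝ (⊤ : ℕ∞) g ∧
      ∀ x ∈ sphere (0 : E) 1, dist (F x) (g x) < ε / 2 := by
    have := ContinuousMap.dense_setOfPred_contDiff F
    rw [mem_closure_iff_nhds_basis
      (nhds_basis_uniformity Metric.uniformity_basis_dist.compactConvergenceUniformity)] at this
    obtain ⟨g, hg, h⟩ := this (sphere 0 1, ε / 2) ⟨isCompact_sphere _ _, by positivity⟩
    exact ⟨g, hg, fun x hx => by simpa [dist_comm] using h x hx⟩
  have hnull : (Measure.addHaar : Measure E) (g '' sphere 0 1) = 0 :=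
    addHaar_image_eq_zero_of_differentiableOn_of_addHaar_eq_zero _
      (hg.differentiable (by simp)).differentiableOn (Measure.addHaar_sphere _ _ _)
  have hdense : Dense (g '' sphere (0 : E) 1)ᶜ :=
    Measure.dense_of_ae (μ := (Measure.addHaar : Measure E)) (compl_mem_ae_iff.2 hnull)
  obtain ⟨v, hv, hvε⟩ := hdense.exists_dist_lt (0 : E) (half_pos hε)
  refine ⟨⟨fun x => g x - v, by fun_prop⟩, fun x hx => hv ⟨x, x.2, sub_eq_zero.1 hx⟩,
    fun x => ?_⟩
  have h1 : F x = f x := DFunLike.congr_fun hF x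
  have h2 := hgF x x.2
  rw [h1, dist_eq_norm, norm_sub_rev] at h2
  rw [dist_zero_left] at hvε
  have : g x - v - f x = (g x - f x) - v := by abel
  calc ‖g x - v - f x‖ = ‖(g x - f x) - v‖ := by rw [this]
    _ ≤ ‖g x - f x‖ + ‖v‖ := norm_sub_le _ _
    _ < ε := by linarith

/-- If nowhere vanishing maps are dense, then so are those which are odd with respect to one
and even with respect to the other of two commuting involutions acting freely. -/
theorem exists_odd_even_nonvanishing {X F : Type*} [MetricSpace X] [CompactSpace X]
    [NormedAddCommGroup F] [NormedSpace ℝ F]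
    (hF : ∀ (f : C(X, F)) (ε : ℝ), 0 < ε →
      ∃ P : C(X, F), (∀ x, P x ≠ 0) ∧ ∀ x, ‖P x - f x‖ < ε)
    (a b : C(X, X)) (ha : ∀ x, a (a x) = x) (hb : ∀ x, b (b x) = x)
    (hab : ∀ x, a (b x) = b (a x)) (ha1 : ∀ x, a x ≠ x) (hb1 : ∀ x, b x ≠ x)
    (hab1 : ∀ x, a (b x) ≠ x) :
    ∃ f : C(X, F), (∀ x, f (a x) = -f x) ∧ (∀ x, f (b x) = f x) ∧ ∀ x, f x ≠ 0 := by
  have hfree (g : C(X, X)) (hg : ∀ x, g x ≠ x) : ∃ ρ : ℝ, 0 < ρ ∧ ∀ x, ρ ≤ dist (g x) x := by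
    obtain ⟨ρ, h0, h⟩ := isCompact_univ.exists_forall_le' (a := (0 : ℝ))
      (f := fun x => dist (g x) x) (by fun_prop) (fun x _ => dist_pos.2 (hg x))
    exact ⟨ρ, h0, fun x => h x trivial⟩
  obtain ⟨ρ, hρ, hρa, hρb, hρab⟩ : ∃ ρ : ℝ, 0 < ρ ∧ (∀ x, ρ ≤ dist (a x) x) ∧
      (∀ x, ρ ≤ dist (b x) x) ∧ ∀ x, ρ ≤ dist (a (b x)) x := by
    obtain ⟨ρ₁, h1, h1'⟩ := hfree a ha1
    obtain ⟨ρ₂, h2, h2'⟩ := hfree b hb1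
    obtain ⟨ρ₃, h3, h3'⟩ := hfree (a.comp b) hab1
    exact ⟨min ρ₁ (min ρ₂ ρ₃), by positivity, fun x => (min_le_left _ _).trans (h1' x),
      fun x => ((min_le_right _ _).trans (min_le_left _ _)).trans (h2' x),
      fun x => ((min_le_right _ _).trans (min_le_right _ _)).trans (h3' x)⟩
  obtain ⟨T, -, hT, hcover⟩ := finite_cover_balls_of_compact (isCompact_univ (X := X))
    (e := ρ / 4) (by positivity)
  suffices h : ∃ f : C(X, F), (∀ x, f (a x) = -f x) ∧ (∀ x, f (b x) = f x) ∧
      ∀ x ∈ ⋃ y ∈ T, closedBall y (ρ / 4), f x ≠ 0 by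
    obtain ⟨f, h1, h2, h3⟩ := h
    refine ⟨f, h1, h2, fun x => h3 x ?_⟩
    exact Set.iUnion₂_mono (fun y _ => ball_subset_closedBall) (hcover (Set.mem_univ x))
  clear hcover
  induction T, hT using Set.Finite.induction_on with
  | empty => exact ⟨0, by simp, by simp, by simp⟩
  | @insert y T _ hTf ih =>
    obtain ⟨f, hfa, hfb, hf⟩ := ih
    have hK : IsCompact (⋃ y ∈ T, closedBall y (ρ / 4)) :=
      hTf.isCompact_biUnion fun y _ => isClosed_closedBall.isCompact
    obtain ⟨m, hm, hmf⟩ := hK.exists_forall_le' (a := (0 : ℝ)) (f := fun x => ‖f x‖)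
      (by fun_prop) (fun x hx => norm_pos_iff.2 (hf x hx))
    obtain ⟨P, hP, hPf⟩ := hF f (m / 4) (by positivity)
    set ψ : C(X, ℝ) := ⟨fun x => max 0 (min 1 (2 - 4 / ρ * dist x y)), by fun_prop⟩ with hψ
    have hψ0 (x : X) : 0 ≤ ψ x := le_max_left _ _
    have hψ1 (x : X) : ψ x ≤ 1 := max_le zero_le_one (min_le_left _ _)
    have hψin (x : X) (hx : dist x y ≤ ρ / 4) : ψ x = 1 := by
      have : 4 / ρ * dist x y ≤ 1 := by
        calc 4 / ρ * dist x y ≤ 4 / ρ * (ρ / 4) := by gcongr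
          _ = 1 := by field_simp
      simp only [hψ, ContinuousMap.coe_mk]
      rw [min_eq_left (by linarith), max_eq_right zero_le_one]
    have hψout (x : X) (hx : ρ / 2 ≤ dist x y) : ψ x = 0 := by
      have : 2 ≤ 4 / ρ * dist x y := by
        calc 2 = 4 / ρ * (ρ / 2) := by field_simp; norm_num
          _ ≤ _ := by gcongr
      simp only [hψ, ContinuousMap.coe_mk]
      exact max_eq_left ((min_le_right _ _).trans (by linarith))
    set q : C(X, F) := ⟨fun x => ψ x • (P x - f x), by fun_prop⟩ with hq
    have hqn (x : X) : ‖q x‖ < m / 4 := by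
      refine lt_of_le_of_lt ?_ (hPf x)
      simp only [hq, ContinuousMap.coe_mk, norm_smul, Real.norm_eq_abs, abs_of_nonneg (hψ0 x)]
      exact mul_le_of_le_one_left (norm_nonneg _) (hψ1 x)
    have hqout (x : X) (hx : ρ / 2 ≤ dist x y) : q x = 0 := by
      simp [hq, hψout x hx]
    refine ⟨f + q - q.comp a + q.comp b - q.comp (a.comp b), fun x => ?_, fun x => ?_,
      fun x hx => ?_⟩
    · simp only [ContinuousMap.sub_apply, ContinuousMap.add_apply, ContinuousMap.comp_apply, ← hab,
        ha, hfa]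
      abel
    · simp only [ContinuousMap.sub_apply, ContinuousMap.add_apply, ContinuousMap.comp_apply, hb,
        hfb, hab]
      abel
    · simp only [ContinuousMap.sub_apply, ContinuousMap.add_apply, ContinuousMap.comp_apply]
      rw [Set.biUnion_insert] at hx
      rcases hx with hx | hx
      · have hx' : dist x y ≤ ρ / 4 := hx
        have hfar (x' : X) (h : ρ ≤ dist x' x) : q x' = 0 := by
          refine hqout x' ?_
          linarith [dist_triangle x' y x, dist_comm x y]
        rw [hfar _ (hρa x), hfar _ (hρb x), hfar _ (hρab x)]
        simpa [hq, hψin x hx'] using hP x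
      · intro h0
        have h1 : f x = q (a x) + q (a (b x)) - q x - q (b x) := by
          rw [← sub_eq_zero, ← h0]; abel
        have h2 := hmf x hx
        rw [h1] at h2
        have h3 := norm_sub_le (q (a x) + q (a (b x)) - q x) (q (b x))
        have h4 := norm_sub_le (q (a x) + q (a (b x))) (q x)
        have h5 := norm_add_le (q (a x)) (q (a (b x)))
        linarith [hqn x, hqn (a x), hqn (b x), hqn (a (b x))]

end Equivariant

namespace TupleChain

section Signs

/-- A coordinate in which `x` does not vanish, equal to the `i`-th one if possible. -/
noncomputable def nonzeroCoord {n : ℕ} (i : ℕ) (x : Fin (n + 1) → ℝ) : Fin (n + 1) :=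
  Classical.epsilon fun k => x k ≠ 0 ∧ ∀ h : i < n + 1, x ⟨i, h⟩ ≠ 0 → k = ⟨i, h⟩

/-- The sign of the `i`-th coordinate, or of some other coordinate if that one vanishes. -/
noncomputable def coordSign {n : ℕ} (i : ℕ) (x : Fin (n + 1) → ℝ) : ZMod 2 :=
  if 0 < x (nonzeroCoord i x) then 1 else 0

variable {n : ℕ}

theorem nonzeroCoord_spec (i : ℕ) {x : Fin (n + 1) → ℝ} (hx : x ≠ 0) :
    x (nonzeroCoord i x) ≠ 0 ∧
      ∀ h : i < n + 1, x ⟨i, h⟩ ≠ 0 → nonzeroCoord i x = ⟨i, h⟩ := by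
  refine Classical.epsilon_spec
    (p := fun k => x k ≠ 0 ∧ ∀ h : i < n + 1, x ⟨i, h⟩ ≠ 0 → k = ⟨i, h⟩) ?_
  by_cases h : ∃ h : i < n + 1, x ⟨i, h⟩ ≠ 0
  · obtain ⟨h, h'⟩ := h
    exact ⟨⟨i, h⟩, h', fun _ _ => rfl⟩
  · obtain ⟨k, hk⟩ := Function.ne_iff.1 hx
    exact ⟨k, hk, fun h1 h2 => absurd ⟨h1, h2⟩ h⟩

theorem coordSign_neg (i : ℕ) {x : Fin (n + 1) → ℝ} (hx : x ≠ 0) :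
    coordSign i (-x) = coordSign i x + 1 := by
  have h : nonzeroCoord i (-x) = nonzeroCoord i x := by simp [nonzeroCoord]
  have h0 := (nonzeroCoord_spec i hx).1
  rw [coordSign, coordSign, h, Pi.neg_apply]
  rcases h0.lt_or_gt with h1 | h1
  · simp [h1, h1.le]
  · simp [h1, h1.not_gt, CharTwo.add_self_eq_zero]

theorem abs_le_of_coordSign_ne {i : ℕ} (h : i < n + 1) {x y : Fin (n + 1) → ℝ}
    (hs : coordSign i x ≠ coordSign i y) : |x ⟨i, h⟩| ≤ |x ⟨i, h⟩ - y ⟨i, h⟩| := by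
  by_contra! hlt
  have hx : x ⟨i, h⟩ ≠ 0 := fun h0 => by
    rw [h0, abs_zero] at hlt
    exact (abs_nonneg _).not_gt hlt
  have hy : y ⟨i, h⟩ ≠ 0 := fun h0 => by simp [h0] at hlt
  have hx' := (nonzeroCoord_spec i (Function.ne_iff.2 ⟨_, hx⟩)).2 h hx
  have hy' := (nonzeroCoord_spec i (Function.ne_iff.2 ⟨_, hy⟩)).2 h hy
  refine hs ?_
  rw [coordSign, coordSign, hx', hy']
  congr 1
  rw [eq_iff_iff]
  rcases hx.lt_or_gt with h1 | h1
  · rw [abs_of_neg h1, abs_lt] at hlt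
    constructor <;> intro <;> linarith
  · rw [abs_of_pos h1, abs_lt] at hlt
    constructor <;> intro <;> linarith

theorem ne_of_alternTuple_ne_zero {X : Type*} {s : ℕ → X → ZMod 2} {i : ℕ} {σ : List X}
    (h : alternTuple s i σ ≠ 0) (k : ℕ) (hk : k + 1 < σ.length) :
    s (i + k) σ[k] ≠ s (i + k) σ[k + 1] := by
  induction σ generalizing i k with
  | nil => simp at hk
  | cons v t ih =>
    cases t with
    | nil => simp at hk
    | cons w t =>
      rw [alternTuple] at h
      cases k with
      | zero =>
        intro h'
        simp only [add_zero, List.getElem_cons_zero, List.getElem_cons_succ, zero_add] at h'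
        rw [h', CharTwo.add_self_eq_zero, zero_mul] at h
        exact h rfl
      | succ k =>
        have := ih (right_ne_zero_of_mul h) k (by simpa using hk)
        simpa [add_assoc, add_comm 1 k] using this

/-- The cup product of all coordinate signs of a nowhere vanishing map vanishes on tuples of
small mesh. -/
theorem alternTuple_coordSign_eq_zero {E : Type*} [PseudoMetricSpace E] {S : Set E}
    {f : E → Fin (n + 1) → ℝ} (hf : UniformContinuousOn f S) {m : ℝ} (hm : 0 < m)
    (hfm : ∀ x ∈ S, m ≤ ‖f x‖) :
    ∃ ε > 0, ∀ σ ∈ fine S ε, σ.length = n + 2 →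
      alternTuple (fun i x => coordSign i (f x)) 0 σ = 0 := by
  obtain ⟨ε, hε, h⟩ := Metric.uniformContinuousOn_iff.1 hf (m / 2) (by positivity)
  refine ⟨ε, hε, fun σ hσ hl => ?_⟩
  by_contra hne
  have hcoord {u v : E} (hu : u ∈ σ) (hv : v ∈ σ) (k : Fin (n + 1)) :
      |f u k - f v k| < m / 2 :=
    (dist_le_pi_dist (f u) (f v) k).trans_lt
      (h u (hσ u hu).1 v (hσ v hv).1 ((hσ u hu).2 v hv))
  have h0 : σ[0] ∈ σ := List.getElem_mem _
  refine (hfm σ[0] (hσ _ h0).1).not_gt ((pi_norm_lt_iff hm).2 fun k => ?_)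
  have hk := k.2
  have h1 := ne_of_alternTuple_ne_zero hne k (by omega)
  rw [zero_add] at h1
  have h2 := abs_le_of_coordSign_ne hk h1
  have h3 : σ[(k : ℕ)] ∈ σ := List.getElem_mem _
  have h4 := h2.trans_lt (hcoord h3 (List.getElem_mem _) k)
  have h5 := hcoord h0 h3 k
  have h6 := abs_sub_abs_le_abs_sub (f σ[0] k) (f σ[(k : ℕ)] k)
  rw [Real.norm_eq_abs]
  simp only [Fin.eta] at h4
  linarith

end Signs

end TupleChain

/-- The Klein four-group does not act freely on a sphere. -/
theorem false_of_commuting_free_involutions {n : ℕ} (a b : C(Sph n, Sph n))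
    (ha : ∀ x, a (a x) = x) (hb : ∀ x, b (b x) = x) (hab : ∀ x, a (b x) = b (a x))
    (ha1 : ∀ x, a x ≠ x) (hb1 : ∀ x, b x ≠ x) (hab1 : ∀ x, a (b x) ≠ x) : False := by
  classical
  obtain ⟨p⟩ : Nonempty (Sph n) :=
    (NormedSpace.sphere_nonempty (E := EuclideanSpace ℝ (Fin (n + 1)))).2 zero_le_one |>.to_subtype
  let r (x : EuclideanSpace ℝ (Fin (n + 1))) : Sph n :=
    if h : x ∈ sphere 0 1 then ⟨x, h⟩ else p
  have hr (x : Sph n) : r x = x := by simp [r]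
  have hr' {x : EuclideanSpace ℝ (Fin (n + 1))} (hx : x ∈ sphere 0 1) : (r x : _) = x :=
    congrArg Subtype.val (hr ⟨x, hx⟩)
  have huc {Y : Type} [PseudoMetricSpace Y] (g : C(Sph n, Y)) :
      UniformContinuousOn (fun x => g (r x)) (sphere 0 1) := by
    rw [uniformContinuousOn_iff_restrict]
    convert CompactSpace.uniformContinuous_of_continuous g.continuous using 1
    exact funext fun x => congrArg g (hr x)
  have hsign (f : C(Sph n, EuclideanSpace ℝ (Fin (n + 1)))) (hf : ∀ x, f x ≠ 0) :
      ∃ ε > 0, ∀ σ ∈ TupleChain.fine (sphere (0 : EuclideanSpace ℝ (Fin (n + 1))) 1) ε,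
        σ.length = n + 2 →
          TupleChain.alternTuple (fun i x => TupleChain.coordSign i (f (r x)).ofLp) 0 σ = 0 := by
    obtain ⟨m, hm, h⟩ := isCompact_univ.exists_forall_le' (a := (0 : ℝ))
      (f := fun x => ‖(f x).ofLp‖) (by fun_prop)
      (fun x _ => norm_pos_iff.2 fun h => hf x (by ext i; exact congrFun h i))
    exact TupleChain.alternTuple_coordSign_eq_zero
      (huc ⟨fun x => (f x).ofLp, by fun_prop⟩) hm fun x _ => h (r x) trivial
  have hapx (f : C(Sph n, EuclideanSpace ℝ (Fin (n + 1)))) (ε : ℝ) (hε : 0 < ε) :=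
    exists_nonvanishing_approx f hε
  obtain ⟨f, hfa, hfb, hf⟩ := exists_odd_even_nonvanishing hapx a b ha hb hab ha1 hb1 hab1
  obtain ⟨t, htb, hta, ht⟩ := exists_odd_even_nonvanishing hapx b a hb ha (fun x => (hab x).symm)
    hb1 ha1 (fun x => hab x ▸ hab1 x)
  have hneg {g : C(Sph n, EuclideanSpace ℝ (Fin (n + 1)))} (hg : ∀ x, g x ≠ 0) (i : ℕ)
      (x : Sph n) : TupleChain.coordSign i (-g x).ofLp =
        TupleChain.coordSign i (g x).ofLp + 1 :=
    TupleChain.coordSign_neg i fun h => hg x (by ext i; exact congrFun h i)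
  refine TupleChain.false_of_sign_functions
    (E := EuclideanSpace ℝ (Fin (n + 1))) (n := n) (by simp)
    (a := fun x => a (r x)) (b := fun x => b (r x))
    (fun x _ => (a (r x)).2) (fun x _ => (b (r x)).2)
    (huc ⟨fun x => (a x : EuclideanSpace ℝ (Fin (n + 1))), by fun_prop⟩)
    (huc ⟨fun x => (b x : EuclideanSpace ℝ (Fin (n + 1))), by fun_prop⟩)
    (fun x hx => by rw [hr, ha, hr' hx]) (fun x hx => by rw [hr, hb, hr' hx])
    (s := fun i x => TupleChain.coordSign i (f (r x)).ofLp)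
    (t := fun i x => TupleChain.coordSign i (t (r x)).ofLp)
    (fun x _ i => ?_) (fun x _ i => ?_) (fun x _ i => ?_) (hsign f hf) (hsign t ht)
  · simp only [hr, hfa, hneg hf]
  · simp only [hr, hfb]
  · simp only [hr, htb, hneg ht]

/-- In every action of `A₄` on a sphere, an involution has a fixed point if it generates a
Klein four-group together with its conjugate under an element permuting its involutions
cyclically. -/
theorem exists_fixedPoint_of_alternatingGroup_four {n : ℕ}
    (φ : alternatingGroup (Fin 4) →* (Sph n ≃ₜ Sph n)) {a b g : alternatingGroup (Fin 4)}
    (ha : a * a = 1) (hb : b = g * a * g⁻¹) (hab : a * b = g * b * g⁻¹) (hcomm : a * b = b * a) :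
    ∃ x, φ a x = x := by
  by_contra! h
  have hmul (u v : alternatingGroup (Fin 4)) (x : Sph n) : φ u (φ v x) = φ (u * v) x := by
    rw [map_mul]; rfl
  have hone (x : Sph n) : φ 1 x = x := by rw [map_one]; rfl
  have hconj {u : alternatingGroup (Fin 4)} (hu : ∀ x, φ u x ≠ x) (x : Sph n) :
      φ (g * u * g⁻¹) x ≠ x := fun hx => hu (φ g⁻¹ x) <| by
    calc φ u (φ g⁻¹ x) = φ g⁻¹ (φ (g * u * g⁻¹) x) := by
          rw [hmul, hmul]; congr 2; group
      _ = φ g⁻¹ x := by rw [hx]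
  have hb2 : b * b = 1 := by
    rw [hb, show g * a * g⁻¹ * (g * a * g⁻¹) = g * (a * a) * g⁻¹ by group, ha]; group
  have h1 : ∀ x, φ b x ≠ x := hb ▸ hconj h
  have h2 : ∀ x, φ (a * b) x ≠ x := hab ▸ hconj h1
  refine false_of_commuting_free_involutions (φ a : C(Sph n, Sph n)) (φ b : C(Sph n, Sph n))
    (fun x => ?_) (fun x => ?_) (fun x => ?_) h h1 fun x hx => h2 x ?_
  · exact (hmul a a x).trans (by rw [ha, hone])
  · exact (hmul b b x).trans (by rw [hb2, hone])
  · exact (hmul a b x).trans (by rw [hcomm]; exact (hmul b a x).symm)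
  · exact (hmul a b x).symm.trans hx

/-- **No product action of `A₄` on a product of two spheres (after Oliver).** For all
`n, m ≥ 1`, there are no continuous actions of the alternating group `A₄` on `S^n` and
`S^m` whose diagonal action on `S^n × S^m` is free. -/
theorem a4_has_no_free_product_action_on_product_of_two_spheres
    (n m : ℕ) (hn : 1 ≤ n) (hm : 1 ≤ m)
    (φ : alternatingGroup (Fin 4) →* (Sph n ≃ₜ Sph n))
    (ψ : alternatingGroup (Fin 4) →* (Sph m ≃ₜ Sph m)) :
    ¬ ∀ (g : alternatingGroup (Fin 4)) (x : Sph n) (y : Sph m),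
        φ g x = x ∧ ψ g y = y → g = 1 := by
  intro h
  obtain ⟨a, b, g, ha1, ha, hb, hab, hcomm⟩ : ∃ a b g : alternatingGroup (Fin 4),
      a ≠ 1 ∧ a * a = 1 ∧ b = g * a * g⁻¹ ∧ a * b = g * b * g⁻¹ ∧ a * b = b * a := by
    refine ⟨⟨Equiv.swap 0 1 * Equiv.swap 2 3, by simp [Equiv.Perm.mem_alternatingGroup]⟩,
      ⟨Equiv.swap 0 2 * Equiv.swap 1 3, by simp [Equiv.Perm.mem_alternatingGroup]⟩,
      ⟨Equiv.swap 1 2 * Equiv.swap 2 3, by simp [Equiv.Perm.mem_alternatingGroup]⟩, ?_⟩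
    decide
  obtain ⟨x, hx⟩ := exists_fixedPoint_of_alternatingGroup_four φ ha hb hab hcomm
  obtain ⟨y, hy⟩ := exists_fixedPoint_of_alternatingGroup_four ψ ha hb hab hcomm
  exact ha1 (h a x y ⟨hx, hy⟩)
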